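/- There exist constants 0 < c₁ ≤ c₂ < ∞, depending only on S and T, such that: whenever x, y ∈ Σ and n ∈ ℕ satisfy y ∈ [x_1…x_{n−1}] \ [x_1…x_n], and either |x_n − y_n| > 1, or |x_n − y_n| = 1 and π_S([x_1…x_{n+1}]) ∩ π_S([y_1…y_{n+1}]) = ∅, then c₁ ≤ D_Θ(π_S(x), π_S(y)) / e^{S_nχ(x)} ≤ c₂. -/

import Mathlib

open Set Filter Topology

noncomputable section

/-- The unit interval `𝒰 = [0,1]`. -/
abbrev UI : Set ℝ := Set.Icc 0 1

/-- An expanding piecewise `C^{1+ε}` map of the unit interval, presented through its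
`d` increasing full inverse branches (ordered left to right, images covering `𝒰` with
pairwise disjoint interiors), each branch being a `C^{1+ε}` diffeomorphism onto its image
whose derivative is `ε`-Hölder continuous with values in `(0,1)`. -/
structure ExpMap (d : ℕ) (ε : ℝ) : Type where
  toFun : ℝ → ℝ
  branch : Fin d → ℝ → ℝ
  branchDeriv : Fin d → ℝ → ℝ
  maps_to : Set.MapsTo toFun UI UI
  branch_maps_to : ∀ a, Set.MapsTo (branch a) UI UI
  branch_mono : ∀ a, StrictMonoOn (branch a) UI
  right_inv : ∀ a, ∀ ξ ∈ Set.Ico (0 : ℝ) 1, toFun (branch a ξ) = ξ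
  map_one : toFun 1 = 1
  branch_hasDeriv : ∀ a, ∀ ξ ∈ UI, HasDerivWithinAt (branch a) (branchDeriv a ξ) UI ξ
  branchDeriv_mem : ∀ a, ∀ ξ ∈ UI, branchDeriv a ξ ∈ Set.Ioo (0 : ℝ) 1
  branchDeriv_holder : ∀ a, ∃ C > 0, ∀ ξ ∈ UI, ∀ η ∈ UI,
      |branchDeriv a ξ - branchDeriv a η| ≤ C * |ξ - η| ^ ε
  ordered : ∀ a b : Fin d, a < b → ∀ ξ ∈ UI, ∀ η ∈ UI, branch a ξ ≤ branch b η
  cover : UI ⊆ ⋃ a, branch a '' UI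

/-- The shift map on `Σ = {1,…,d}^ℕ` (`x n` represents the letter `x_{n+1}`). -/
def shift {d : ℕ} (x : ℕ → Fin d) : ℕ → Fin d := fun n => x (n + 1)

/-- The cylinder set `[x_1 … x_n]`. -/
def cyl {d : ℕ} (x : ℕ → Fin d) (n : ℕ) : Set (ℕ → Fin d) := {y | ∀ m < n, y m = x m}

/-- Finite approximations `S_{x_1}^{-1} ∘ ⋯ ∘ S_{x_n}^{-1}(0)` to the coding map. -/
def approx {d : ℕ} {ε : ℝ} (S : ExpMap d ε) (x : ℕ → Fin d) (n : ℕ) : ℝ :=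
  (List.range n).foldr (fun m ξ => S.branch (x m) ξ) 0

/-- The coding map `π_S : Σ → 𝒰`. -/
def proj {d : ℕ} {ε : ℝ} (S : ExpMap d ε) (x : ℕ → Fin d) : ℝ := ⨆ n, approx S x n

/-- The potential `φ(x) = log (S_{x_1}^{-1})'(π_S(σ x))` associated with `S`. -/
def pot {d : ℕ} {ε : ℝ} (S : ExpMap d ε) (x : ℕ → Fin d) : ℝ :=
  Real.log (S.branchDeriv (x 0) (proj S (shift x)))

/-- Birkhoff sums `S_n f(x) = ∑_{m=0}^{n-1} f(σ^m x)`. -/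
def birk {d : ℕ} (f : (ℕ → Fin d) → ℝ) (n : ℕ) (x : ℕ → Fin d) : ℝ :=
  ∑ m ∈ Finset.range n, f (shift^[m] x)

/-- The difference quotient `D_Θ(ξ, η) = (Θ(ξ) - Θ(η))/(ξ - η)`. -/
def DQ (Θ : ℝ → ℝ) (ξ η : ℝ) : ℝ := (Θ ξ - Θ η) / (ξ - η)

/-- `Θ` is the conjugacy between `S` and `T` : an increasing homeomorphism of `𝒰`
with `T ∘ Θ = Θ ∘ S`. -/
def IsConjugacy {d : ℕ} {ε : ℝ} (S T : ExpMap d ε) (Θ : ℝ → ℝ) : Prop :=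
  StrictMonoOn Θ UI ∧ ContinuousOn Θ UI ∧ Θ '' UI = UI ∧
    ∀ ξ ∈ UI, T.toFun (Θ ξ) = Θ (S.toFun ξ)

/-- `x` has an `i`-block of length `k` at the `n`-th level:
`x_{n+1} = ⋯ = x_{n+k} = i` and `x_{n+k+1} ≠ i`. -/
def HasBlock {d : ℕ} (x : ℕ → Fin d) (i : Fin d) (k n : ℕ) : Prop :=
  (∀ m < k, x (n + m) = i) ∧ x (n + k) ≠ i

/-- `x` is eventually constant. -/
def EvConst {d : ℕ} (x : ℕ → Fin d) : Prop := ∃ N : ℕ, ∃ i : Fin d, ∀ n ≥ N, x n = i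

/-- `Θ'(ξ)` exists in the generalised sense: `lim_{η→ξ} D_Θ(ξ,η)` exists in `[0,∞]`
(with one-sided limits at the boundary points). -/
def GenDeriv (Θ : ℝ → ℝ) (ξ : ℝ) : Prop :=
  (∃ L : ℝ, Filter.Tendsto (fun η => DQ Θ ξ η) (nhdsWithin ξ (UI \ {ξ})) (nhds L)) ∨
    Filter.Tendsto (fun η => DQ Θ ξ η) (nhdsWithin ξ (UI \ {ξ})) Filter.atTop

namespace ExpMap

variable {d : ℕ} {ε : ℝ} (S : ExpMap d ε)

lemma branch_monotoneOn (a : Fin d) : MonotoneOn (S.branch a) UI :=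
  (S.branch_mono a).monotoneOn

lemma branch_continuousOn (a : Fin d) : ContinuousOn (S.branch a) UI :=
  fun ξ hξ => (S.branch_hasDeriv a ξ hξ).continuousWithinAt

lemma zero_mem : (0 : ℝ) ∈ UI := ⟨le_rfl, zero_le_one⟩

lemma one_mem : (1 : ℝ) ∈ UI := ⟨zero_le_one, le_rfl⟩

/-- Mean value theorem for an inverse branch, between ordered points. -/
lemma exists_slope_of_lt (a : Fin d) {ξ η : ℝ} (hξ : ξ ∈ UI) (hη : η ∈ UI) (h : ξ < η) :
    ∃ ζ ∈ UI, ζ ∈ Ioo ξ η ∧ S.branch a η - S.branch a ξ = S.branchDeriv a ζ * (η - ξ) := by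
  have hsub : Icc ξ η ⊆ UI := Icc_subset_Icc hξ.1 hη.2
  obtain ⟨ζ, hζ, he⟩ := exists_hasDerivAt_eq_slope (S.branch a) (S.branchDeriv a) h
    ((S.branch_continuousOn a).mono hsub) fun t ht =>
      (S.branch_hasDeriv a t (hsub ⟨ht.1.le, ht.2.le⟩)).hasDerivAt
        (Icc_mem_nhds (hξ.1.trans_lt ht.1) (ht.2.trans_le hη.2))
  refine ⟨ζ, hsub ⟨hζ.1.le, hζ.2.le⟩, hζ, ?_⟩
  rw [he, div_mul_cancel₀ _ (sub_pos.2 h).ne']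

/-- Mean value theorem for an inverse branch, for distances of arbitrary points. -/
lemma exists_slope_abs (a : Fin d) {ξ η : ℝ} (hξ : ξ ∈ UI) (hη : η ∈ UI) :
    ∃ ζ ∈ UI, |ζ - ξ| ≤ |ξ - η| ∧
      |S.branch a ξ - S.branch a η| = S.branchDeriv a ζ * |ξ - η| := by
  rcases lt_trichotomy ξ η with h | rfl | h
  · obtain ⟨ζ, hζ, hb, he⟩ := S.exists_slope_of_lt a hξ hη h
    refine ⟨ζ, hζ, ?_, ?_⟩
    · rw [abs_of_pos (by linarith [hb.1]), abs_of_neg (by linarith)]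
      linarith [hb.2]
    · rw [abs_sub_comm, he, abs_mul, abs_of_pos (S.branchDeriv_mem a ζ hζ).1, abs_sub_comm]
  · exact ⟨ξ, hξ, by simp, by simp⟩
  · obtain ⟨ζ, hζ, hb, he⟩ := S.exists_slope_of_lt a hη hξ h
    refine ⟨ζ, hζ, ?_, ?_⟩
    · rw [abs_of_neg (by linarith [hb.2]), abs_of_pos (by linarith)]
      linarith [hb.1]
    · rw [he, abs_mul, abs_of_pos (S.branchDeriv_mem a ζ hζ).1]

lemma branchDeriv_continuousOn (hε : 0 < ε) (a : Fin d) : ContinuousOn (S.branchDeriv a) UI := by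
  obtain ⟨C, -, h⟩ := S.branchDeriv_holder a
  intro ξ hξ
  rw [ContinuousWithinAt, tendsto_iff_dist_tendsto_zero]
  have hlim : Tendsto (fun η => C * |η - ξ| ^ ε) (𝓝[UI] ξ) (𝓝 0) := by
    have hc : Continuous fun η : ℝ => C * |η - ξ| ^ ε :=
      continuous_const.mul ((continuous_abs.comp (continuous_id.sub continuous_const)).rpow_const
        fun _ => Or.inr hε.le)
    have := hc.tendsto ξ
    simp only [sub_self, abs_zero, Real.zero_rpow hε.ne', mul_zero] at this
    exact this.mono_left nhdsWithin_le_nhds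
  refine squeeze_zero' (Eventually.of_forall fun _ => dist_nonneg) ?_ hlim
  filter_upwards [self_mem_nhdsWithin] with η hη
  exact h η hη ξ hξ

/-- Uniform bounds on the derivatives of all inverse branches. -/
lemma exists_deriv_bounds (hd : 2 ≤ d) (hε : 0 < ε) :
    ∃ c l : ℝ, 0 < c ∧ c ≤ l ∧ l < 1 ∧
      ∀ a, ∀ ξ ∈ UI, c ≤ S.branchDeriv a ξ ∧ S.branchDeriv a ξ ≤ l := by
  have : Nonempty (Fin d) := ⟨⟨0, by omega⟩⟩
  have hmin : ∀ a, ∃ ξ ∈ UI, IsMinOn (S.branchDeriv a) UI ξ := fun a =>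
    isCompact_Icc.exists_isMinOn ⟨0, zero_mem⟩ (S.branchDeriv_continuousOn hε a)
  have hmax : ∀ a, ∃ ξ ∈ UI, IsMaxOn (S.branchDeriv a) UI ξ := fun a =>
    isCompact_Icc.exists_isMaxOn ⟨0, zero_mem⟩ (S.branchDeriv_continuousOn hε a)
  choose p hp hp' using hmin
  choose q hq hq' using hmax
  obtain ⟨a₀, ha₀⟩ := Finite.exists_min fun a => S.branchDeriv a (p a)
  obtain ⟨a₁, ha₁⟩ := Finite.exists_max fun a => S.branchDeriv a (q a)
  have hb : ∀ a, ∀ ξ ∈ UI, S.branchDeriv a₀ (p a₀) ≤ S.branchDeriv a ξ ∧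
      S.branchDeriv a ξ ≤ S.branchDeriv a₁ (q a₁) := fun a ξ hξ =>
    ⟨(ha₀ a).trans (hp' a hξ), le_trans (hq' a hξ) (ha₁ a)⟩
  refine ⟨_, _, (S.branchDeriv_mem a₀ _ (hp a₀)).1, ?_, (S.branchDeriv_mem a₁ _ (hq a₁)).2, hb⟩
  exact (hb a₀ 0 zero_mem).1.trans (hb a₀ 0 zero_mem).2

/-- A uniform Hölder constant for the derivatives of all inverse branches. -/
lemma exists_holder_const : ∃ C > 0, ∀ a, ∀ ξ ∈ UI, ∀ η ∈ UI,
    |S.branchDeriv a ξ - S.branchDeriv a η| ≤ C * |ξ - η| ^ ε := by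
  choose C hC h using S.branchDeriv_holder
  refine ⟨1 + ∑ a, C a, ?_, fun a ξ hξ η hη => (h a ξ hξ η hη).trans ?_⟩
  · have := Finset.sum_nonneg fun a (_ : a ∈ Finset.univ) => (hC a).le
    linarith
  · have := Finset.single_le_sum (fun a (_ : a ∈ Finset.univ) => (hC a).le) (Finset.mem_univ a)
    exact mul_le_mul_of_nonneg_right (by linarith) (Real.rpow_nonneg (abs_nonneg _) _)

lemma branch_one_eq_branch_zero {a b : Fin d} (h : (a : ℕ) + 1 = b) :
    S.branch a 1 = S.branch b 0 := by
  have hab : a < b := Fin.lt_def.2 (by omega)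
  refine (S.ordered a b hab 1 one_mem 0 zero_mem).antisymm ?_
  by_contra! hlt
  have ha := S.branch_maps_to a one_mem
  have hb := S.branch_maps_to b zero_mem
  obtain ⟨e, ξ, hξ, he⟩ := mem_iUnion.1 (S.cover
    (show (S.branch a 1 + S.branch b 0) / 2 ∈ UI from
      ⟨by linarith [ha.1, hb.1], by linarith [ha.2, hb.2]⟩))
  rcases lt_trichotomy e a with hea | rfl | hea
  · linarith [S.ordered e a hea ξ hξ 1 one_mem]
  · linarith [S.branch_monotoneOn e hξ one_mem hξ.2]
  · rcases (show b ≤ e from Fin.le_def.2 (by have := Fin.lt_def.1 hea; omega)).eq_or_lt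
      with rfl | hbe
    · linarith [S.branch_monotoneOn b zero_mem hξ hξ.1]
    · linarith [S.ordered b e hbe 0 zero_mem ξ hξ]

lemma branch_last_one {a : Fin d} (h : (a : ℕ) + 1 = d) : S.branch a 1 = 1 := by
  refine (S.branch_maps_to a one_mem).2.antisymm ?_
  obtain ⟨e, ξ, hξ, he⟩ := mem_iUnion.1 (S.cover one_mem)
  rcases (show e ≤ a from Fin.le_def.2 (by omega)).eq_or_lt with rfl | hea
  · exact he.symm.le.trans (S.branch_monotoneOn e hξ one_mem hξ.2)
  · exact he.symm.le.trans (S.ordered e a hea ξ hξ 1 one_mem)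

lemma branch_first_zero {a : Fin d} (h : (a : ℕ) = 0) : S.branch a 0 = 0 := by
  refine le_antisymm ?_ (S.branch_maps_to a zero_mem).1
  obtain ⟨e, ξ, hξ, he⟩ := mem_iUnion.1 (S.cover zero_mem)
  rcases (show a ≤ e from Fin.le_def.2 (by omega)).eq_or_lt with rfl | hea
  · exact le_of_le_of_eq (S.branch_monotoneOn a zero_mem hξ hξ.1) he
  · exact le_of_le_of_eq (S.ordered a e hea 0 zero_mem ξ hξ) he

lemma exists_eq_branch_zero {v : ℝ} (hv : v ∈ UI) (h : S.toFun v = 0) :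
    ∃ b, v = S.branch b 0 := by
  obtain ⟨b, η, hη, rfl⟩ := mem_iUnion.1 (S.cover hv)
  rcases hη.2.eq_or_lt with rfl | h1
  · by_cases hb : (b : ℕ) + 1 < d
    · exact ⟨⟨b + 1, hb⟩, S.branch_one_eq_branch_zero rfl⟩
    · rw [S.branch_last_one (by omega), S.map_one] at h
      exact absurd h one_ne_zero
  · rw [S.right_inv b η ⟨hη.1, h1⟩] at h
    exact ⟨b, by rw [h]⟩

/-! ### The coding map -/

lemma approx_succ (x : ℕ → Fin d) (n : ℕ) :
    approx S x (n + 1) = S.branch (x 0) (approx S (shift x) n) := by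
  simp [approx, List.range_succ_eq_map, List.foldr_map, shift]

lemma approx_mem (x : ℕ → Fin d) (n : ℕ) : approx S x n ∈ UI := by
  induction n generalizing x with
  | zero => simp [approx]
  | succ n ih => rw [approx_succ]; exact S.branch_maps_to _ (ih _)

lemma approx_monotone (x : ℕ → Fin d) : Monotone (approx S x) := by
  refine monotone_nat_of_le_succ fun n => ?_
  induction n generalizing x with
  | zero => simpa [approx] using (S.approx_mem x 1).1
  | succ n ih =>
    rw [approx_succ, approx_succ S x (n + 1)]
    exact S.branch_monotoneOn _ (S.approx_mem _ _) (S.approx_mem _ _) (ih _)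

lemma tendsto_approx (x : ℕ → Fin d) : Tendsto (approx S x) atTop (𝓝 (proj S x)) :=
  tendsto_atTop_ciSup (S.approx_monotone x) ⟨1, by rintro _ ⟨n, rfl⟩; exact (S.approx_mem x n).2⟩

lemma proj_mem (x : ℕ → Fin d) : proj S x ∈ UI :=
  isClosed_Icc.mem_of_tendsto (S.tendsto_approx x) (Eventually.of_forall (S.approx_mem x))

lemma proj_eq (x : ℕ → Fin d) : proj S x = S.branch (x 0) (proj S (shift x)) := by
  refine tendsto_nhds_unique ((tendsto_add_atTop_iff_nat 1).2 (S.tendsto_approx x)) ?_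
  simp only [approx_succ]
  exact (S.branch_continuousOn (x 0) _ (S.proj_mem _)).tendsto.comp
    (tendsto_nhdsWithin_iff.2 ⟨S.tendsto_approx _, Eventually.of_forall (S.approx_mem _)⟩)

/-- An inverse branch has at most one fixed point. -/
lemma branch_fixed_unique (a : Fin d) {ξ η : ℝ} (hξ : ξ ∈ UI) (hη : η ∈ UI)
    (h : S.branch a ξ = ξ) (h' : S.branch a η = η) : ξ = η := by
  obtain ⟨ζ, hζ, -, he⟩ := S.exists_slope_abs a hξ hη
  rw [h, h'] at he
  by_contra hne
  have := abs_pos.2 (sub_ne_zero.2 hne)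
  nlinarith [(S.branchDeriv_mem a ζ hζ).2]

lemma proj_const_last {a : Fin d} (h : (a : ℕ) + 1 = d) : proj S (fun _ => a) = 1 :=
  S.branch_fixed_unique a (S.proj_mem _) one_mem (S.proj_eq fun _ => a).symm (S.branch_last_one h)

lemma proj_const_first {a : Fin d} (h : (a : ℕ) = 0) : proj S (fun _ => a) = 0 :=
  S.branch_fixed_unique a (S.proj_mem _) zero_mem (S.proj_eq fun _ => a).symm
    (S.branch_first_zero h)

lemma shift_iterate_apply (x : ℕ → Fin d) (m k : ℕ) : (shift^[m] x) k = x (k + m) := by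
  induction m generalizing x with
  | zero => rfl
  | succ m ih => rw [Function.iterate_succ_apply, ih]; simp [shift, add_assoc]

lemma proj_eq_of_agree {x y : ℕ → Fin d} {m : ℕ} (h : ∀ k < m, y k = x k)
    (he : proj S (shift^[m] x) = proj S (shift^[m] y)) : proj S x = proj S y := by
  induction m generalizing x y with
  | zero => exact he
  | succ m ih =>
    rw [S.proj_eq x, S.proj_eq y, h 0 (by omega),
      ih (x := shift x) (y := shift y) (fun k hk => h (k + 1) (by omega)) he]

end ExpMap

/-- The sequence `x` starts to the left of `y`, and their cylinders of length two have at least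
one cylinder of length two between them. -/
def SepLT {d : ℕ} (x y : ℕ → Fin d) : Prop :=
  (x 0 : ℕ) + 1 < y 0 ∨ ((x 0 : ℕ) + 1 = y 0 ∧ ((x 1 : ℕ) + 1 < d ∨ 0 < (y 1 : ℕ)))

namespace ExpMap

variable {d : ℕ} {ε : ℝ} (S : ExpMap d ε)

lemma not_disjoint_of_adjacent {x y : ℕ → Fin d} {m : ℕ} (h : ∀ k < m, y k = x k)
    (hxy : (x m : ℕ) + 1 = y m) (hx : (x (m + 1) : ℕ) + 1 = d) (hy : (y (m + 1) : ℕ) = 0) :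
    ((proj S '' cyl x (m + 2)) ∩ (proj S '' cyl y (m + 2))).Nonempty := by
  set X : ℕ → Fin d := fun k => if k ≤ m then x k else x (m + 1) with hX
  set Y : ℕ → Fin d := fun k => if k ≤ m then y k else y (m + 1) with hY
  have hXY : proj S X = proj S Y := by
    refine S.proj_eq_of_agree (m := m) (fun k hk => by simp [hX, hY, hk.le, h k hk]) ?_
    have h1 : shift (shift^[m] X) = fun _ => x (m + 1) := by
      funext k
      have : ¬ (k + 1 + m ≤ m) := by omega
      simp [shift, shift_iterate_apply, hX, this]
    have h2 : shift (shift^[m] Y) = fun _ => y (m + 1) := by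
      funext k
      have : ¬ (k + 1 + m ≤ m) := by omega
      simp [shift, shift_iterate_apply, hY, this]
    rw [S.proj_eq (shift^[m] X), S.proj_eq (shift^[m] Y), h1, h2, S.proj_const_last hx,
      S.proj_const_first hy]
    simpa [shift_iterate_apply, hX, hY] using S.branch_one_eq_branch_zero hxy
  refine ⟨proj S X, ⟨X, fun k hk => ?_, rfl⟩, ⟨Y, fun k hk => ?_, hXY.symm⟩⟩
  · by_cases hkm : k ≤ m
    · simp [hX, hkm]
    · obtain rfl : k = m + 1 := by omega
      simp [hX]
  · by_cases hkm : k ≤ m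
    · simp [hY, hkm]
    · obtain rfl : k = m + 1 := by omega
      simp [hY]

/-- The hypothesis on the pair of sequences, in terms of letters only. -/
lemma sepLT_or_sepLT {x y : ℕ → Fin d} {m : ℕ} (h : ∀ k < m, y k = x k)
    (hs : 1 < |((x m : ℕ) : ℤ) - ((y m : ℕ) : ℤ)| ∨
      (|((x m : ℕ) : ℤ) - ((y m : ℕ) : ℤ)| = 1 ∧
        (proj S '' cyl x (m + 2)) ∩ (proj S '' cyl y (m + 2)) = ∅)) :
    SepLT (shift^[m] x) (shift^[m] y) ∨ SepLT (shift^[m] y) (shift^[m] x) := by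
  simp only [SepLT, shift_iterate_apply, zero_add, add_comm 1 m]
  rcases hs with hs | ⟨hs, hdis⟩
  · rcases lt_abs.1 hs with h1 | h1 <;> omega
  · rcases (abs_eq zero_le_one).1 hs with h1 | h1
    · by_contra hcon
      have := S.not_disjoint_of_adjacent (x := y) (y := x) (fun k hk => (h k hk).symm) (m := m)
        (by omega) (by omega) (by omega)
      rw [inter_comm, hdis] at this
      exact not_nonempty_empty this
    · by_contra hcon
      have := S.not_disjoint_of_adjacent h (by omega) (by omega) (by omega)
      rw [hdis] at this
      exact not_nonempty_empty this

lemma mul_sub_le_branch_sub {c : ℝ} (hc : ∀ a, ∀ ξ ∈ UI, c ≤ S.branchDeriv a ξ) (a : Fin d)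
    {ξ η : ℝ} (hξ : ξ ∈ UI) (hη : η ∈ UI) (h : ξ ≤ η) :
    c * (η - ξ) ≤ S.branch a η - S.branch a ξ := by
  rcases h.eq_or_lt with rfl | h
  · simp
  · obtain ⟨ζ, hζ, -, he⟩ := S.exists_slope_of_lt a hξ hη h
    rw [he]
    exact mul_le_mul_of_nonneg_right (hc a ζ hζ) (sub_nonneg.2 h.le)

lemma sq_le_proj_sub_of_sepLT {c : ℝ} (h0 : 0 < c) (h1 : c < 1)
    (hc : ∀ a, ∀ ξ ∈ UI, c ≤ S.branchDeriv a ξ) {x y : ℕ → Fin d} (h : SepLT x y) :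
    c ^ 2 ≤ proj S y - proj S x := by
  have hx1 : proj S x ≤ S.branch (x 0) 1 := by
    rw [S.proj_eq]
    exact S.branch_monotoneOn _ (S.proj_mem _) one_mem (S.proj_mem _).2
  have hy1 : S.branch (y 0) 0 ≤ proj S y := by
    rw [S.proj_eq y]
    exact S.branch_monotoneOn _ zero_mem (S.proj_mem _) (S.proj_mem _).1
  have hlen : ∀ a b, c ^ 2 ≤ S.branch a (S.branch b 1) - S.branch a (S.branch b 0) := by
    intro a b
    have e1 := S.mul_sub_le_branch_sub hc b zero_mem one_mem zero_le_one
    have e2 := S.mul_sub_le_branch_sub hc a (S.branch_maps_to b zero_mem)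
      (S.branch_maps_to b one_mem) (by linarith)
    nlinarith
  rcases h with h | ⟨h, h' | h'⟩
  · have hb : (x 0 : ℕ) + 1 < d := by omega
    have e1 := S.ordered (x 0) ⟨x 0 + 1, hb⟩ (Fin.lt_def.2 (by simp)) 1 one_mem 0 zero_mem
    have e2 := S.ordered ⟨x 0 + 1, hb⟩ (y 0) (Fin.lt_def.2 h) 1 one_mem 0 zero_mem
    have e3 := S.mul_sub_le_branch_sub hc ⟨x 0 + 1, hb⟩ zero_mem one_mem zero_le_one
    nlinarith
  · have hx2 : proj S x ≤ S.branch (x 0) (S.branch ⟨x 1 + 1, h'⟩ 0) := by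
      rw [S.proj_eq x]
      refine S.branch_monotoneOn _ (S.proj_mem _) (S.branch_maps_to _ zero_mem) ?_
      rw [S.proj_eq]
      exact S.ordered (x 1) _ (Fin.lt_def.2 (by simp)) _ (S.proj_mem _) 0 zero_mem
    have e1 : S.branch (x 0) (S.branch ⟨x 1 + 1, h'⟩ 1) ≤ S.branch (x 0) 1 :=
      S.branch_monotoneOn _ (S.branch_maps_to _ one_mem) one_mem (S.branch_maps_to _ one_mem).2
    have e2 := S.ordered (x 0) (y 0) (Fin.lt_def.2 (by omega)) 1 one_mem 0 zero_mem
    linarith [hlen (x 0) ⟨x 1 + 1, h'⟩]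
  · have hz : 0 < d := by omega
    have hy2 : S.branch (y 0) (S.branch ⟨0, hz⟩ 1) ≤ proj S y := by
      rw [S.proj_eq y]
      refine S.branch_monotoneOn _ (S.branch_maps_to _ one_mem) (S.proj_mem _) ?_
      rw [S.proj_eq (shift y)]
      exact S.ordered _ (y 1) (Fin.lt_def.2 h') 1 one_mem _ (S.proj_mem _)
    have e1 : S.branch (y 0) 0 ≤ S.branch (y 0) (S.branch ⟨0, hz⟩ 0) :=
      S.branch_monotoneOn _ zero_mem (S.branch_maps_to _ zero_mem) (S.branch_maps_to _ zero_mem).1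
    have e2 := S.ordered (x 0) (y 0) (Fin.lt_def.2 (by omega)) 1 one_mem 0 zero_mem
    linarith [hlen (y 0) ⟨0, hz⟩]

/-! ### Bounded distortion -/

lemma abs_proj_sub_le {l : ℝ} (h0 : 0 ≤ l) (hl : ∀ a, ∀ ξ ∈ UI, S.branchDeriv a ξ ≤ l)
    {x y : ℕ → Fin d} {m : ℕ} (h : ∀ k < m, y k = x k) : |proj S x - proj S y| ≤ l ^ m := by
  induction m generalizing x y with
  | zero =>
    have hx := S.proj_mem x
    have hy := S.proj_mem y
    rw [pow_zero, abs_le]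
    constructor <;> linarith [hx.1, hx.2, hy.1, hy.2]
  | succ m ih =>
    rw [S.proj_eq x, S.proj_eq y, h 0 (by omega)]
    obtain ⟨ζ, hζ, -, he⟩ := S.exists_slope_abs (x 0) (S.proj_mem (shift x)) (S.proj_mem (shift y))
    rw [he, pow_succ']
    exact mul_le_mul (hl _ _ hζ) (ih fun k hk => h (k + 1) (by omega)) (abs_nonneg _) h0

lemma abs_log_sub_log_le {c a b : ℝ} (hc : 0 < c) (ha : c ≤ a) (hb : c ≤ b) :
    |Real.log a - Real.log b| ≤ |a - b| / c := by
  wlog hab : b ≤ a generalizing a b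
  · rw [abs_sub_comm, abs_sub_comm a]
    exact this hb ha (le_of_not_ge hab)
  have hb0 : 0 < b := hc.trans_le hb
  have ha0 : 0 < a := hc.trans_le ha
  rw [abs_of_nonneg (sub_nonneg.2 (Real.log_le_log hb0 hab)), abs_of_nonneg (sub_nonneg.2 hab),
    ← Real.log_div ha0.ne' hb0.ne']
  calc Real.log (a / b) ≤ a / b - 1 := Real.log_le_sub_one_of_pos (div_pos ha0 hb0)
    _ = (a - b) / b := by field_simp
    _ ≤ (a - b) / c := div_le_div_of_nonneg_left (sub_nonneg.2 hab) hc hb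

lemma birk_succ (f : (ℕ → Fin d) → ℝ) (m : ℕ) (x : ℕ → Fin d) :
    birk f (m + 1) x = f x + birk f m (shift x) := by
  simp [birk, Finset.sum_range_succ', Function.iterate_succ_apply, add_comm]

lemma abs_log_distortion_le {c l C : ℝ} (hε : 0 < ε) (h0 : 0 < c) (hl0 : 0 ≤ l) (hC : 0 < C)
    (hc : ∀ a, ∀ ξ ∈ UI, c ≤ S.branchDeriv a ξ ∧ S.branchDeriv a ξ ≤ l)
    (hH : ∀ a, ∀ ξ ∈ UI, ∀ η ∈ UI, |S.branchDeriv a ξ - S.branchDeriv a η| ≤ C * |ξ - η| ^ ε)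
    {x y : ℕ → Fin d} {m : ℕ} (h : ∀ k < m, y k = x k)
    (hne : proj S (shift^[m] x) ≠ proj S (shift^[m] y)) :
    proj S x ≠ proj S y ∧
      |Real.log |proj S x - proj S y| - Real.log |proj S (shift^[m] x) - proj S (shift^[m] y)|
        - birk (pot S) m x| ≤ C / c * ∑ j ∈ Finset.range m, (l ^ ε) ^ j := by
  induction m generalizing x y with
  | zero => exact ⟨hne, by simp [birk]⟩
  | succ m ih =>
    have hs : ∀ k < m, shift y k = shift x k := fun k hk => h (k + 1) (by omega)
    obtain ⟨hne', hle⟩ := ih hs hne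
    obtain ⟨ζ, hζ, hd, he⟩ :=
      S.exists_slope_abs (x 0) (S.proj_mem (shift x)) (S.proj_mem (shift y))
    have hxy : |proj S x - proj S y| =
        S.branchDeriv (x 0) ζ * |proj S (shift x) - proj S (shift y)| := by
      rw [S.proj_eq x, S.proj_eq y, h 0 (by omega), he]
    have hDpos := (S.branchDeriv_mem (x 0) ζ hζ).1
    have hpos : 0 < |proj S (shift x) - proj S (shift y)| := abs_pos.2 (sub_ne_zero.2 hne')
    refine ⟨sub_ne_zero.1 (abs_pos.1 (hxy ▸ mul_pos hDpos hpos)), ?_⟩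
    rw [hxy, Real.log_mul hDpos.ne' hpos.ne', birk_succ, Finset.sum_range_succ, mul_add]
    have hlog : |Real.log (S.branchDeriv (x 0) ζ) - pot S x| ≤ C / c * (l ^ ε) ^ m := by
      refine (abs_log_sub_log_le h0 (hc _ _ hζ).1 (hc _ _ (S.proj_mem _)).1).trans ?_
      rw [div_mul_eq_mul_div]
      refine div_le_div_of_nonneg_right ((hH _ _ hζ _ (S.proj_mem _)).trans ?_) h0.le
      refine mul_le_mul_of_nonneg_left ?_ hC.le
      rw [← Real.rpow_mul_natCast hl0, mul_comm, Real.rpow_natCast_mul hl0]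
      exact Real.rpow_le_rpow (abs_nonneg _)
        (hd.trans (S.abs_proj_sub_le hl0 (fun a ξ hξ => (hc a ξ hξ).2) hs)) hε.le
    simp only [Function.iterate_succ_apply]
    rw [abs_le] at hle hlog ⊢
    constructor <;> linarith [hle.1, hle.2, hlog.1, hlog.2]

/-- The distance of the codings of two sequences which separate after `m` letters is comparable
to the exponential of a Birkhoff sum. -/
lemma exists_abs_log_proj_sub_le (hd : 2 ≤ d) (hε : 0 < ε) :
    ∃ K : ℝ, ∀ (x y : ℕ → Fin d) (m : ℕ), (∀ k < m, y k = x k) →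
      (SepLT (shift^[m] x) (shift^[m] y) ∨ SepLT (shift^[m] y) (shift^[m] x)) →
      proj S x ≠ proj S y ∧
        |Real.log |proj S x - proj S y| - birk (pot S) (m + 1) x| ≤ K := by
  obtain ⟨c, l, h0, hcl, hl1, hc⟩ := S.exists_deriv_bounds hd hε
  obtain ⟨C, hC, hH⟩ := S.exists_holder_const
  have hl0 : 0 < l := h0.trans_le hcl
  have hρ0 : 0 ≤ l ^ ε := Real.rpow_nonneg hl0.le _
  have hρ1 : l ^ ε < 1 := Real.rpow_lt_one hl0.le hl1 hε
  refine ⟨C / c * (1 - l ^ ε)⁻¹ + (- Real.log (c ^ 2)) + (- Real.log c), fun x y m h hs => ?_⟩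
  have hgap : c ^ 2 ≤ |proj S (shift^[m] x) - proj S (shift^[m] y)| := by
    rcases hs with hs | hs
    · rw [abs_sub_comm]
      exact (S.sq_le_proj_sub_of_sepLT h0 (hcl.trans_lt hl1) (fun a ξ hξ => (hc a ξ hξ).1) hs).trans
        (le_abs_self _)
    · exact (S.sq_le_proj_sub_of_sepLT h0 (hcl.trans_lt hl1) (fun a ξ hξ => (hc a ξ hξ).1) hs).trans
        (le_abs_self _)
  have hpos : 0 < c ^ 2 := by positivity
  obtain ⟨hne, hle⟩ := S.abs_log_distortion_le hε h0 hl0.le hC hc hH h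
    (sub_ne_zero.1 (abs_pos.1 (hpos.trans_le hgap)))
  refine ⟨hne, ?_⟩
  have hsum : C / c * ∑ j ∈ Finset.range m, (l ^ ε) ^ j ≤ C / c * (1 - l ^ ε)⁻¹ := by
    refine mul_le_mul_of_nonneg_left ?_ (by positivity)
    rw [← tsum_geometric_of_lt_one hρ0 hρ1]
    exact (summable_geometric_of_lt_one hρ0 hρ1).sum_le_tsum _ fun j _ => pow_nonneg hρ0 j
  have g1 := Real.log_le_log hpos hgap
  have hle1 : |proj S (shift^[m] x) - proj S (shift^[m] y)| ≤ 1 := by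
    simpa using S.abs_proj_sub_le hl0.le (fun a ξ hξ => (hc a ξ hξ).2)
      (x := shift^[m] x) (y := shift^[m] y) (m := 0) (by simp)
  have g2 := Real.log_nonpos (abs_nonneg _) hle1
  have hq := hc (shift^[m] x 0) _ (S.proj_mem (shift (shift^[m] x)))
  have p1 : Real.log c ≤ pot S (shift^[m] x) := Real.log_le_log h0 hq.1
  have p2 : pot S (shift^[m] x) ≤ 0 :=
    Real.log_nonpos (h0.le.trans hq.1) (hq.2.trans hl1.le)
  have hb : birk (pot S) (m + 1) x = birk (pot S) m x + pot S (shift^[m] x) :=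
    Finset.sum_range_succ _ _
  rw [hb]
  rw [abs_le] at hle ⊢
  constructor <;> linarith [hle.1, hle.2]

end ExpMap

namespace IsConjugacy

open ExpMap

variable {d : ℕ} {ε : ℝ} {S T : ExpMap d ε} {Θ : ℝ → ℝ}

lemma mapsTo (h : IsConjugacy S T Θ) : MapsTo Θ UI UI := mapsTo_iff_image_subset.2 h.2.2.1.subset

lemma map_zero (h : IsConjugacy S T Θ) : Θ 0 = 0 := by
  obtain ⟨ξ, hξ, he⟩ := h.2.2.1.superset zero_mem
  exact le_antisymm (he ▸ h.1.monotoneOn zero_mem hξ hξ.1) (h.mapsTo zero_mem).1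

lemma map_one (h : IsConjugacy S T Θ) : Θ 1 = 1 := by
  obtain ⟨ξ, hξ, he⟩ := h.2.2.1.superset one_mem
  exact le_antisymm (h.mapsTo one_mem).2 (le_of_eq_of_le he.symm (h.1.monotoneOn hξ one_mem hξ.2))

lemma map_branch_zero (h : IsConjugacy S T Θ) (a : Fin d) :
    Θ (S.branch a 0) = T.branch a 0 := by
  have hex : ∀ a, ∃ b, Θ (S.branch a 0) = T.branch b 0 := fun a => by
    refine T.exists_eq_branch_zero (h.mapsTo (S.branch_maps_to a zero_mem)) ?_
    rw [h.2.2.2 _ (S.branch_maps_to a zero_mem), S.right_inv a 0 ⟨le_rfl, one_pos⟩, h.map_zero]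
  choose f hf using hex
  have hlt : ∀ (R : ExpMap d ε) (a b : Fin d), a < b → R.branch a 0 < R.branch b 0 :=
    fun R a b hab => (R.branch_mono a zero_mem one_mem one_pos).trans_le
      (R.ordered a b hab 1 one_mem 0 zero_mem)
  have hmono : StrictMono f := fun a b hab => by
    have h1 := h.1 (S.branch_maps_to a zero_mem) (S.branch_maps_to b zero_mem) (hlt S a b hab)
    rw [hf, hf] at h1
    exact (show StrictMono fun a => T.branch a 0 from fun a b => hlt T a b).lt_iff_lt.1 h1
  rw [hf, show f a = a from le_antisymm hmono.apply_le hmono.le_apply]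

lemma map_branch_one (h : IsConjugacy S T Θ) (a : Fin d) :
    Θ (S.branch a 1) = T.branch a 1 := by
  by_cases ha : (a : ℕ) + 1 < d
  · rw [S.branch_one_eq_branch_zero (b := ⟨a + 1, ha⟩) rfl,
      T.branch_one_eq_branch_zero (b := ⟨a + 1, ha⟩) rfl, h.map_branch_zero]
  · rw [S.branch_last_one (by omega), T.branch_last_one (by omega), h.map_one]

lemma map_branch (h : IsConjugacy S T Θ) (a : Fin d) {ξ : ℝ} (hξ : ξ ∈ UI) :
    Θ (S.branch a ξ) = T.branch a (Θ ξ) := by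
  rcases hξ.2.eq_or_lt with rfl | h1
  · rw [h.map_branch_one, h.map_one]
  have hm := S.branch_maps_to a hξ
  have hlow : T.branch a 0 ≤ Θ (S.branch a ξ) := by
    rw [← h.map_branch_zero]
    exact h.1.monotoneOn (S.branch_maps_to a zero_mem) hm
      (S.branch_monotoneOn a zero_mem hξ hξ.1)
  have hup : Θ (S.branch a ξ) < T.branch a 1 := by
    rw [← h.map_branch_one]
    exact h.1 hm (S.branch_maps_to a one_mem) (S.branch_mono a hξ one_mem h1)
  obtain ⟨η, hη, he⟩ :=
    intermediate_value_Icc zero_le_one (T.branch_continuousOn a) ⟨hlow, hup.le⟩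
  have hη1 : η < 1 := lt_of_le_of_ne hη.2 fun e => by
    rw [e] at he
    exact hup.ne he.symm
  have := h.2.2.2 _ hm
  rw [← he, T.right_inv a η ⟨hη.1, hη1⟩, S.right_inv a ξ ⟨hξ.1, h1⟩] at this
  rw [← he, this]

/-- The conjugacy intertwines the coding maps. -/
lemma map_proj (h : IsConjugacy S T Θ) (x : ℕ → Fin d) : Θ (proj S x) = proj T x := by
  have happ : ∀ n (x : ℕ → Fin d), Θ (approx S x n) = approx T x n := by
    intro n
    induction n with
    | zero => intro x; simpa [approx] using h.map_zero
    | succ n ih =>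
      intro x
      rw [approx_succ, approx_succ, h.map_branch _ (S.approx_mem _ _), ih]
  refine tendsto_nhds_unique ?_ (T.tendsto_approx x)
  rw [show approx T x = Θ ∘ approx S x from funext fun n => (happ n x).symm]
  exact (h.2.1 _ (S.proj_mem x)).tendsto.comp
    (tendsto_nhdsWithin_iff.2 ⟨S.tendsto_approx x, Eventually.of_forall (S.approx_mem x)⟩)

lemma DQ_eq_abs_div (h : IsConjugacy S T Θ) {ξ η : ℝ} (hξ : ξ ∈ UI) (hη : η ∈ UI) :
    DQ Θ ξ η = |Θ ξ - Θ η| / |ξ - η| := by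
  rw [DQ, ← abs_div, eq_comm, abs_eq_self]
  rcases le_total ξ η with hle | hle
  · exact div_nonneg_of_nonpos (sub_nonpos.2 (h.1.monotoneOn hξ hη hle)) (sub_nonpos.2 hle)
  · exact div_nonneg (sub_nonneg.2 (h.1.monotoneOn hη hξ hle)) (sub_nonneg.2 hle)

end IsConjugacy

/-- Lemma `geom2`.  There are constants `0 < c₁ ≤ c₂ < ∞`, depending
only on `S` and `T`, such that whenever `y ∈ [x_1…x_{n-1}] \ [x_1…x_n]` and either
`|x_n - y_n| > 1`, or `|x_n - y_n| = 1` and `π_S([x_1…x_{n+1}]) ∩ π_S([y_1…y_{n+1}]) = ∅`,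
one has `c₁ ≤ D_Θ(π_S x, π_S y)/e^{S_nχ(x)} ≤ c₂`. -/
theorem statement_1 {d : ℕ} {ε : ℝ} (hd : 2 ≤ d) (hε : 0 < ε)
    (S T : ExpMap d ε) (Θ : ℝ → ℝ) (hΘ : IsConjugacy S T Θ) :
    ∃ c₁ c₂ : ℝ, 0 < c₁ ∧ c₁ ≤ c₂ ∧
      ∀ (x y : ℕ → Fin d) (n : ℕ), 1 ≤ n →
        y ∈ cyl x (n - 1) → y ∉ cyl x n →
        (1 < |((x (n - 1) : ℕ) : ℤ) - ((y (n - 1) : ℕ) : ℤ)| ∨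
          (|((x (n - 1) : ℕ) : ℤ) - ((y (n - 1) : ℕ) : ℤ)| = 1 ∧
            (proj S '' cyl x (n + 1)) ∩ (proj S '' cyl y (n + 1)) = ∅)) →
        c₁ ≤ DQ Θ (proj S x) (proj S y) / Real.exp (birk (fun z => pot T z - pot S z) n x) ∧
          DQ Θ (proj S x) (proj S y) / Real.exp (birk (fun z => pot T z - pot S z) n x) ≤ c₂ := by
  obtain ⟨K, hK⟩ := S.exists_abs_log_proj_sub_le hd hε
  obtain ⟨L, hL⟩ := T.exists_abs_log_proj_sub_le hd hε
  have key : ∀ (x y : ℕ → Fin d) (n : ℕ), 1 ≤ n → y ∈ cyl x (n - 1) →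
      (1 < |((x (n - 1) : ℕ) : ℤ) - ((y (n - 1) : ℕ) : ℤ)| ∨
        (|((x (n - 1) : ℕ) : ℤ) - ((y (n - 1) : ℕ) : ℤ)| = 1 ∧
          (proj S '' cyl x (n + 1)) ∩ (proj S '' cyl y (n + 1)) = ∅)) →
      ∃ r : ℝ, |r| ≤ |K| + |L| ∧ DQ Θ (proj S x) (proj S y) /
        Real.exp (birk (fun z => pot T z - pot S z) n x) = Real.exp r := by
    intro x y n hn hy hs
    obtain ⟨m, rfl⟩ : ∃ m, n = m + 1 := ⟨n - 1, by omega⟩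
    rw [Nat.add_sub_cancel] at hy hs
    have hsep := S.sepLT_or_sepLT hy hs
    obtain ⟨hSne, hSle⟩ := hK x y m hy hsep
    obtain ⟨hTne, hTle⟩ := hL x y m hy hsep
    have hSpos : 0 < |proj S x - proj S y| := abs_pos.2 (sub_ne_zero.2 hSne)
    have hTpos : 0 < |proj T x - proj T y| := abs_pos.2 (sub_ne_zero.2 hTne)
    have hbirk : birk (fun z => pot T z - pot S z) (m + 1) x =
        birk (pot T) (m + 1) x - birk (pot S) (m + 1) x := Finset.sum_sub_distrib _ _
    refine ⟨(Real.log |proj T x - proj T y| - birk (pot T) (m + 1) x) -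
      (Real.log |proj S x - proj S y| - birk (pot S) (m + 1) x), ?_, ?_⟩
    · refine (abs_sub _ _).trans ?_
      linarith [le_abs_self K, le_abs_self L]
    · rw [hΘ.DQ_eq_abs_div (S.proj_mem x) (S.proj_mem y), hΘ.map_proj, hΘ.map_proj, hbirk,
        sub_sub_sub_comm, Real.exp_sub, Real.exp_sub, Real.exp_sub, Real.exp_sub,
        Real.exp_log hSpos, Real.exp_log hTpos]
  refine ⟨Real.exp (-(|K| + |L|)), Real.exp (|K| + |L|), Real.exp_pos _,
    Real.exp_le_exp.2 (by linarith [abs_nonneg K, abs_nonneg L]), fun x y n hn hy _ hs => ?_⟩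
  obtain ⟨r, hr, he⟩ := key x y n hn hy hs
  rw [he, Real.exp_le_exp, Real.exp_le_exp]
  exact abs_le.1 hr
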